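/- arXiv:2401.14213 — 2 statements merged into one kernel-verified Lean document; each statement's English description precedes it below -/
import Mathlib

section
/- One has Σ_{i,j,k=1}^{n} C_{ijk}² ≤ (5/4) Σ_{i,j,k=1}^{n} d_{ijk}². -/
/-- A triple sum is invariant under cyclic permutation of the indices of its summand. -/
theorem sum_cyclic {ι M : Type*} [Fintype ι] [AddCommMonoid M] (f : ι → ι → ι → M) :
    ∑ i, ∑ j, ∑ k, f j k i = ∑ i, ∑ j, ∑ k, f i j k := by
  rw [Finset.sum_comm]
  exact Finset.sum_congr rfl fun _ _ => Finset.sum_comm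

theorem stmt7 (n : ℕ) (hn : 1 ≤ n)
    (C : Fin n → Fin n → Fin n → ℝ)
    (hC : ∀ i j k, C i j k = - C i k j)
    (d : Fin n → Fin n → Fin n → ℝ)
    (hd : ∀ i j k, d i j k = C i j k - C j i k) :
    ∑ i, ∑ j, ∑ k, (C i j k) ^ 2 ≤ (5 / 4) * ∑ i, ∑ j, ∑ k, (d i j k) ^ 2 := by
  have hd' : ∀ i j k, d i j k = C i j k + C j k i := fun i j k => by
    rw [hd, hC j i k, sub_neg_eq_add]
  have hcyc : ∑ i, ∑ j, ∑ k, (C i j k ^ 2 + C j k i ^ 2 + C k i j ^ 2) ≤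
      ∑ i, ∑ j, ∑ k, (d i j k ^ 2 + d j k i ^ 2 + d k i j ^ 2) := by
    refine Finset.sum_le_sum fun i _ => Finset.sum_le_sum fun j _ => Finset.sum_le_sum fun k _ => ?_
    rw [hd' i, hd' j, hd' k]
    nlinarith [sq_nonneg (C i j k + C j k i + C k i j)]
  simp only [Finset.sum_add_distrib] at hcyc
  have hC₁ := sum_cyclic fun i j k => C i j k ^ 2
  have hC₂ := sum_cyclic fun i j k => C j k i ^ 2
  have hd₁ := sum_cyclic fun i j k => d i j k ^ 2
  have hd₂ := sum_cyclic fun i j k => d j k i ^ 2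
  have hnonneg : 0 ≤ ∑ i, ∑ j, ∑ k, d i j k ^ 2 :=
    Finset.sum_nonneg fun _ _ => Finset.sum_nonneg fun _ _ => Finset.sum_nonneg fun _ _ => sq_nonneg _
  linarith
end

section
/- If S and T are skew-symmetric 2n×2n real matrices, then −(1/4) tr((J₀S − SJ₀)(T + J₀TJ₀)) = (1/2) Σ_{i,j=1}^{n} (α^S_{ij} β^T_{ij} − β^S_{ij} α^T_{ij}). -/
noncomputable section

open Matrix

/-- The standard complex structure matrix `J₀ = [[0, -Iₙ],[Iₙ, 0]]` on `ℝ^{2n}`,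
with rows and columns indexed by `Fin n ⊕ Fin n` (`Sum.inl i` is the index `i`
and `Sum.inr i` is the index `i + n`). -/
def J0 (n : ℕ) : Matrix (Fin n ⊕ Fin n) (Fin n ⊕ Fin n) ℝ :=
  Matrix.fromBlocks 0 (-1) 1 0

/-- For a `2n × 2n` matrix `S`, the `n × n` matrix `α^S` with
`α^S_{ij} = S_{i, j+n} + S_{i+n, j}`. -/
def alphaMat {n : ℕ} (S : Matrix (Fin n ⊕ Fin n) (Fin n ⊕ Fin n) ℝ) :
    Matrix (Fin n) (Fin n) ℝ :=
  Matrix.of fun i j => S (Sum.inl i) (Sum.inr j) + S (Sum.inr i) (Sum.inl j)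

/-- For a `2n × 2n` matrix `S`, the `n × n` matrix `β^S` with
`β^S_{ij} = S_{i+n, j+n} - S_{ij}`. -/
def betaMat {n : ℕ} (S : Matrix (Fin n ⊕ Fin n) (Fin n ⊕ Fin n) ℝ) :
    Matrix (Fin n) (Fin n) ℝ :=
  Matrix.of fun i j => S (Sum.inr i) (Sum.inr j) - S (Sum.inl i) (Sum.inl j)

theorem transpose_alphaMat {n : ℕ} {S : Matrix (Fin n ⊕ Fin n) (Fin n ⊕ Fin n) ℝ}
    (hS : Sᵀ = -S) : (alphaMat S)ᵀ = -alphaMat S := by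
  have h (a b) : S b a = -S a b := congrFun₂ hS a b
  ext i j
  simp only [alphaMat, transpose_apply, of_apply, Matrix.neg_apply]
  linarith [h (.inl i) (.inr j), h (.inr i) (.inl j)]

theorem transpose_betaMat {n : ℕ} {S : Matrix (Fin n ⊕ Fin n) (Fin n ⊕ Fin n) ℝ}
    (hS : Sᵀ = -S) : (betaMat S)ᵀ = -betaMat S := by
  have h (a b) : S b a = -S a b := congrFun₂ hS a b
  ext i j
  simp only [betaMat, transpose_apply, of_apply, Matrix.neg_apply]
  linarith [h (.inl i) (.inl j), h (.inr i) (.inr j)]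

theorem J0_mul_sub_mul_J0 {n : ℕ} (S : Matrix (Fin n ⊕ Fin n) (Fin n ⊕ Fin n) ℝ) :
    J0 n * S - S * J0 n =
      fromBlocks (-alphaMat S) (-betaMat S) (-betaMat S) (alphaMat S) := by
  conv_lhs => rw [← fromBlocks_toBlocks S]
  ext (i | i) (j | j) <;>
    simp [J0, fromBlocks_multiply, alphaMat, betaMat, toBlocks₁₁, toBlocks₁₂, toBlocks₂₁,
      toBlocks₂₂] <;> ring

theorem add_J0_mul_mul_J0 {n : ℕ} (T : Matrix (Fin n ⊕ Fin n) (Fin n ⊕ Fin n) ℝ) :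
    T + J0 n * T * J0 n =
      fromBlocks (-betaMat T) (alphaMat T) (alphaMat T) (betaMat T) := by
  conv_lhs => rw [← fromBlocks_toBlocks T]
  ext (i | i) (j | j) <;>
    simp [J0, fromBlocks_multiply, alphaMat, betaMat, toBlocks₁₁, toBlocks₁₂, toBlocks₂₁,
      toBlocks₂₂] <;> ring

theorem trace_mul_of_transpose_eq_neg {n : ℕ} (X : Matrix (Fin n) (Fin n) ℝ)
    {Y : Matrix (Fin n) (Fin n) ℝ} (hY : Yᵀ = -Y) :
    trace (X * Y) = -∑ i, ∑ j, X i j * Y i j := by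
  have h (i j) : Y j i = -Y i j := congrFun₂ hY i j
  simp only [trace, diag_apply, mul_apply, ← Finset.sum_neg_distrib]
  refine Finset.sum_congr rfl fun i _ => Finset.sum_congr rfl fun j _ => ?_
  rw [h i j, mul_neg]

theorem trace_fromBlocks_eq_add {n : ℕ} (A B C D : Matrix (Fin n) (Fin n) ℝ) :
    trace (fromBlocks A B C D) = trace A + trace D := by
  simp [trace, Fintype.sum_sum_type]

theorem stmt10 (n : ℕ) (hn : 1 ≤ n)
    (S T : Matrix (Fin n ⊕ Fin n) (Fin n ⊕ Fin n) ℝ)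
    (hS : Sᵀ = -S) (hT : Tᵀ = -T) :
    -(1 / 4) * Matrix.trace ((J0 n * S - S * J0 n) * (T + J0 n * T * J0 n)) =
      (1 / 2) * ∑ i, ∑ j,
        (alphaMat S i j * betaMat T i j - betaMat S i j * alphaMat T i j) := by
  rw [J0_mul_sub_mul_J0, add_J0_mul_mul_J0, fromBlocks_multiply, trace_fromBlocks_eq_add]
  simp only [neg_mul, mul_neg, neg_neg, trace_add, trace_neg,
    trace_mul_of_transpose_eq_neg _ (transpose_alphaMat hT),
    trace_mul_of_transpose_eq_neg _ (transpose_betaMat hT), Finset.sum_sub_distrib]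
  ring
end
end
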